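/- arXiv:1810.05064 — 2 statements merged into one kernel-verified Lean document; each statement's English description precedes it below -/
import Mathlib

section
/- Let δ ≥ 1, k ≥ 1 be integers, let ψ ≥ 1 be a real, and let G = (V, E) be a geometric directed graph in ℝ^δ satisfying the kissing-type hypothesis with parameter ψ: for every v ∈ V and every Q ⊆ V \ {v} such that every q ∈ Q satisfies dist(q, v) ≤ dist(q, q') for all q' ∈ Q \ {q}, one has |Q| ≤ ψ. Let I be a set of incomplete vertices of G each of which has deg(v) ≥ k. Then the set W = {u ∈ V : u is a witness of some v ∈ I} of witnesses has |W| ≥ |I| / (k·ψ). -/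
attribute [local instance] Classical.propDecidable

/-- The out-neighborhood `N(v)` of a vertex in a directed graph given by an edge set. -/
noncomputable def nbrs {V : Type*} [Fintype V] (E : Finset (V × V)) (v : V) : Finset V :=
  Finset.univ.filter (fun u => (v, u) ∈ E)

/-- `u` is a witness of `v`: `u ≠ v`, `u` is a `k`-nearest neighbor of `v`, and the
edge `(v, u)` is missing. -/
def Witness {V : Type*} [Fintype V] {δ : ℕ} (k : ℕ)
    (coord : V → EuclideanSpace ℝ (Fin δ)) (E : Finset (V × V)) (v u : V) : Prop :=
  u ≠ v ∧
    (Finset.univ.filter (fun w => w ≠ v ∧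
      dist (coord v) (coord w) < dist (coord v) (coord u))).card ≤ k - 1 ∧
    (v, u) ∉ E

/-- A vertex `v` is incomplete if `deg(v) < k` or `v` has a witness. -/
def Incomplete {V : Type*} [Fintype V] {δ : ℕ} (k : ℕ)
    (coord : V → EuclideanSpace ℝ (Fin δ)) (E : Finset (V × V)) (v : V) : Prop :=
  (nbrs E v).card < k ∨ ∃ u : V, Witness k coord E v u

/-- A set in which every point has fewer than `k` other points strictly closer than `u` contains
a `1/k` fraction whose points are all at least as close to `u` as to each other. -/
theorem exists_subset_dist_le_and_card_le_mul {V X : Type*} [PseudoMetricSpace X] (f : V → X)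
    (u : V) {k : ℕ} (hk : 1 ≤ k) (P : Finset V)
    (hP : ∀ v ∈ P, (P.filter (fun w => w ≠ v ∧
      dist (f v) (f w) < dist (f v) (f u))).card ≤ k - 1) :
    ∃ Q ⊆ P, (∀ q ∈ Q, ∀ q' ∈ Q, q' ≠ q → dist (f q) (f u) ≤ dist (f q) (f q')) ∧
      P.card ≤ k * Q.card := by
  induction P using Finset.strongInduction with
  | H P ih =>
    rcases P.eq_empty_or_nonempty with rfl | hne
    · exact ⟨∅, by simp⟩
    obtain ⟨q, hq, hmax⟩ := P.exists_max_image (fun v => dist (f v) (f u)) hne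
    set R := P.filter (fun w => w ≠ q ∧ dist (f q) (f w) < dist (f q) (f u)) with hR
    set S := P \ insert q R with hS
    have hSP : S ⊆ P := Finset.sdiff_subset
    have hqS : q ∉ S := by simp [hS]
    have hSlt : S ⊂ P := (Finset.ssubset_iff_of_subset hSP).2 ⟨q, hq, hqS⟩
    obtain ⟨Q, hQS, hQ, hcard⟩ := ih S hSlt fun v hv =>
      (Finset.card_le_card (Finset.filter_subset_filter _ hSP)).trans (hP v (hSP hv))
    have hfar : ∀ p ∈ Q, dist (f q) (f u) ≤ dist (f q) (f p) := by
      intro p hp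
      have hpS := hQS hp
      simp only [hS, hR, Finset.mem_sdiff, Finset.mem_insert, Finset.mem_filter, not_or,
        not_and, not_lt] at hpS
      exact hpS.2.2 hpS.1 hpS.2.1
    refine ⟨insert q Q, Finset.insert_subset hq (hQS.trans hSP), ?_, ?_⟩
    · intro a ha b hb hab
      rcases Finset.mem_insert.1 ha with rfl | haQ
      · exact hfar b (Finset.mem_of_mem_insert_of_ne hb hab)
      rcases Finset.mem_insert.1 hb with rfl | hbQ
      · rw [dist_comm (f a) (f b)]
        exact (hmax a (hSP (hQS haQ))).trans (hfar a haQ)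
      · exact hQ a haQ b hbQ hab
    · rw [Finset.card_insert_of_notMem fun h => hqS (hQS h)]
      have hPS : P.card ≤ S.card + (insert q R).card :=
        Finset.card_le_card_sdiff_add_card
      have hins : (insert q R).card ≤ R.card + 1 := Finset.card_insert_le _ _
      have hRk : R.card ≤ k - 1 := hP q hq
      have hmul : k * (Q.card + 1) = k * Q.card + k := by ring
      omega

/-- intermediate claim in the analysis of the sample `T` of the tester:
under the kissing-type hypothesis with parameter `ψ`, a set `I` of incomplete vertices
of degree at least `k` has at least `|I| / (k·ψ)` distinct witnesses. -/
theorem stmt8 (δ k : ℕ) (hδ : 1 ≤ δ) (hk : 1 ≤ k) (ψ : ℝ) (hψ : 1 ≤ ψ)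
    (V : Type*) [Fintype V] (coord : V → EuclideanSpace ℝ (Fin δ)) (E : Finset (V × V))
    (hkiss : ∀ v : V, ∀ Q : Finset V, v ∉ Q →
      (∀ q ∈ Q, ∀ q' ∈ Q, q' ≠ q →
        dist (coord q) (coord v) ≤ dist (coord q) (coord q')) →
      (Q.card : ℝ) ≤ ψ)
    (I : Finset V) (hI : ∀ v ∈ I, Incomplete k coord E v ∧ k ≤ (nbrs E v).card) :
    (I.card : ℝ) / ((k : ℝ) * ψ) ≤
      ((Finset.univ.filter (fun u => ∃ v ∈ I, Witness k coord E v u)).card : ℝ) := by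
  have hfiber : ∀ u : V, ((I.filter (fun v => Witness k coord E v u)).card : ℝ) ≤ k * ψ := by
    intro u
    obtain ⟨Q, hQP, hQ, hcard⟩ := exists_subset_dist_le_and_card_le_mul coord u hk
      (I.filter (fun v => Witness k coord E v u)) fun v hv =>
        (Finset.card_le_card (Finset.filter_subset_filter _ (Finset.subset_univ _))).trans
          (Finset.mem_filter.1 hv).2.2.1
    have huQ : u ∉ Q := fun h => (Finset.mem_filter.1 (hQP h)).2.1 rfl
    calc ((I.filter (fun v => Witness k coord E v u)).card : ℝ)
        ≤ k * Q.card := by exact_mod_cast hcard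
      _ ≤ k * ψ := by gcongr; exact hkiss u Q huQ hQ
  have hkψ : 0 < (k : ℝ) * ψ := by
    have : (0 : ℝ) < k := by exact_mod_cast hk
    positivity
  set W := Finset.univ.filter (fun u => ∃ v ∈ I, Witness k coord E v u) with hW
  have hcover : I ⊆ W.biUnion fun u => I.filter (fun v => Witness k coord E v u) := by
    intro v hv
    obtain ⟨u, hu⟩ := (hI v hv).1.resolve_left (hI v hv).2.not_gt
    simp only [hW, Finset.mem_biUnion, Finset.mem_filter, Finset.mem_univ, true_and]
    exact ⟨u, ⟨v, hv, hu⟩, hv, hu⟩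
  rw [div_le_iff₀ hkψ]
  calc (I.card : ℝ)
      ≤ ∑ u ∈ W, ((I.filter (fun v => Witness k coord E v u)).card : ℝ) := by
        exact_mod_cast (Finset.card_le_card hcover).trans Finset.card_biUnion_le
    _ ≤ W.card • ((k : ℝ) * ψ) := Finset.sum_le_card_nsmul _ _ _ fun u _ => hfiber u
    _ = W.card * ((k : ℝ) * ψ) := nsmul_eq_mul _ _
end

section
/- Let k ≥ 1 and m ≥ 1 be integers, and consider the m·(k+1) points of ℝ given by p(i, j) = 3·(k+1)·i + j for i ∈ {0, …, m−1} and j ∈ {0, …, k} (m 'line gadgets' of k+1 consecutive integer points each, at pairwise distance at least 2k+3 from each other). Then for every (i, j), the set of k-nearest neighbors of p(i, j) among these points, i.e., the set of points u ≠ p(i, j) with |{w ≠ p(i, j) : dist(p(i, j), w) < dist(p(i, j), u)}| ≤ k − 1, is exactly {p(i, j') : j' ∈ {0, …, k}, j' ≠ j}. Consequently, the geometric directed graph on these points whose edge set is {(p(i, j), p(i, j')) : 0 ≤ i ≤ m−1, j ≠ j'} (a disjoint union of complete directed graphs, one per gadget) is a k-NN graph. -/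
attribute [local instance] Classical.propDecidable

/-- `(V, E)` with coordinates `coord : V → ℝ` is a `k`-NN graph: every vertex `v` has a
set `K` of `min k (|V| - 1)` vertices other than `v`, all of them out-neighbors of `v`,
that are at least as close to `v` as every vertex outside `K ∪ {v}`. -/
def IsKNNGraph {V : Type*} [Fintype V] (k : ℕ) (coord : V → ℝ)
    (E : Finset (V × V)) : Prop :=
  ∀ v : V, ∃ K : Finset V, v ∉ K ∧ K.card = min k (Fintype.card V - 1) ∧
    (∀ u ∈ K, (v, u) ∈ E) ∧
    ∀ u ∈ K, ∀ w : V, w ∉ K → w ≠ v →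
      dist (coord v) (coord u) ≤ dist (coord v) (coord w)

theorem dist_le_of_same_gadget {k m : ℕ} {coord : Fin m × Fin (k + 1) → ℝ}
    (hcoord : ∀ v, coord v = 3 * (k + 1) * (v.1 : ℕ) + (v.2 : ℕ))
    {v u : Fin m × Fin (k + 1)} (h : u.1 = v.1) : dist (coord v) (coord u) ≤ k := by
  rw [Real.dist_eq, hcoord, hcoord, h, abs_le]
  have hv : ((v.2 : ℕ) : ℝ) ≤ k := by exact_mod_cast Nat.lt_succ_iff.mp v.2.2
  have hu : ((u.2 : ℕ) : ℝ) ≤ k := by exact_mod_cast Nat.lt_succ_iff.mp u.2.2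
  have hv0 : (0 : ℝ) ≤ (v.2 : ℕ) := Nat.cast_nonneg _
  have hu0 : (0 : ℝ) ≤ (u.2 : ℕ) := Nat.cast_nonneg _
  constructor <;> linarith

theorem lt_dist_of_ne_gadget {k m : ℕ} {coord : Fin m × Fin (k + 1) → ℝ}
    (hcoord : ∀ v, coord v = 3 * (k + 1) * (v.1 : ℕ) + (v.2 : ℕ))
    {v u : Fin m × Fin (k + 1)} (h : u.1 ≠ v.1) : (k : ℝ) < dist (coord v) (coord u) := by
  rw [Real.dist_eq, hcoord, hcoord, lt_abs]
  have hv : ((v.2 : ℕ) : ℝ) ≤ k := by exact_mod_cast Nat.lt_succ_iff.mp v.2.2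
  have hu : ((u.2 : ℕ) : ℝ) ≤ k := by exact_mod_cast Nat.lt_succ_iff.mp u.2.2
  have hv0 : (0 : ℝ) ≤ (v.2 : ℕ) := Nat.cast_nonneg _
  have hu0 : (0 : ℝ) ≤ (u.2 : ℕ) := Nat.cast_nonneg _
  have hk0 : (0 : ℝ) ≤ k := Nat.cast_nonneg _
  rcases lt_or_gt_of_ne h with h | h
  · left
    have h1 : ((u.1 : ℕ) : ℝ) + 1 ≤ (v.1 : ℕ) := by exact_mod_cast h
    nlinarith
  · right
    have h1 : ((v.1 : ℕ) : ℝ) + 1 ≤ (u.1 : ℕ) := by exact_mod_cast h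
    nlinarith

theorem card_gadget_sdiff_singleton {k m : ℕ} (i : Fin m) (j : Fin (k + 1)) :
    (Finset.univ.filter (fun u : Fin m × Fin (k + 1) => u.1 = i ∧ u.2 ≠ j)).card = k := by
  have h : Finset.univ.filter (fun u : Fin m × Fin (k + 1) => u.1 = i ∧ u.2 ≠ j)
      = {i} ×ˢ Finset.univ.erase j := by
    ext u
    simp only [Finset.mem_filter, Finset.mem_product, Finset.mem_singleton, Finset.mem_erase,
      Finset.mem_univ, true_and, and_true]
  rw [h, Finset.card_product, Finset.card_erase_of_mem (Finset.mem_univ j)]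
  simp

/-- structural fact underlying the distribution `D₁` in the lower bound
proof of Theorem 2: for the `m·(k+1)` points `p(i, j) = 3·(k+1)·i + j` of `ℝ`
(`m` line gadgets of `k+1` consecutive integer points each), the set of `k`-nearest
neighbors of `p(i, j)` is exactly `{p(i, j') : j' ≠ j}`, and the disjoint union of the
complete directed graphs on the gadgets is a `k`-NN graph. -/
theorem stmt9 (k m : ℕ) (hk : 1 ≤ k) (hm : 1 ≤ m)
    (coord : Fin m × Fin (k + 1) → ℝ)
    (hcoord : ∀ v, coord v = 3 * (k + 1) * (v.1 : ℕ) + (v.2 : ℕ)) :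
    (∀ i : Fin m, ∀ j : Fin (k + 1),
      (Finset.univ.filter (fun u : Fin m × Fin (k + 1) => u ≠ (i, j) ∧
        (Finset.univ.filter (fun w : Fin m × Fin (k + 1) => w ≠ (i, j) ∧
          dist (coord (i, j)) (coord w) < dist (coord (i, j)) (coord u))).card ≤ k - 1))
      = (Finset.univ.filter (fun u : Fin m × Fin (k + 1) => u.1 = i ∧ u.2 ≠ j))) ∧
    IsKNNGraph k coord
      (Finset.univ.filter
        (fun e : (Fin m × Fin (k + 1)) × (Fin m × Fin (k + 1)) =>
          e.1.1 = e.2.1 ∧ e.1.2 ≠ e.2.2)) := by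
  refine ⟨fun i j => ?_, fun v => ?_⟩
  · ext u
    simp only [Finset.mem_filter, Finset.mem_univ, true_and]
    constructor
    · rintro ⟨hu, hcard⟩
      by_cases h : u.1 = i
      · exact ⟨h, fun h2 => hu (Prod.ext h h2)⟩
      · exfalso
        have hle := (card_gadget_sdiff_singleton i j).symm.trans_le
          ((Finset.card_le_card fun w hw => ?_).trans hcard)
        · omega
        · simp only [Finset.mem_filter, Finset.mem_univ, true_and] at hw ⊢
          exact ⟨fun hwv => hw.2 (congrArg Prod.snd hwv),
            (dist_le_of_same_gadget hcoord hw.1).trans_lt (lt_dist_of_ne_gadget hcoord h)⟩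
    · rintro ⟨h1, h2⟩
      refine ⟨fun h => h2 (congrArg Prod.snd h), ?_⟩
      refine Nat.le_sub_one_of_lt ((Finset.card_lt_card ?_).trans_eq
        (card_gadget_sdiff_singleton i j))
      refine (Finset.ssubset_iff_of_subset fun w hw => ?_).2 ⟨u, by simp [h1, h2], by simp⟩
      simp only [Finset.mem_filter, Finset.mem_univ, true_and] at hw ⊢
      have hwi : w.1 = i := by
        by_contra h
        exact (hw.2.trans_le (dist_le_of_same_gadget hcoord h1)).not_gt
          (lt_dist_of_ne_gadget hcoord h)
      exact ⟨hwi, fun h => hw.1 (Prod.ext hwi h)⟩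
  · refine ⟨Finset.univ.filter (fun u => u.1 = v.1 ∧ u.2 ≠ v.2), by simp, ?_, fun u hu => ?_,
      fun u hu w hw hwv => ?_⟩
    · rw [card_gadget_sdiff_singleton, Fintype.card_prod, Fintype.card_fin, Fintype.card_fin]
      have := Nat.le_mul_of_pos_left (k + 1) hm
      omega
    · simp only [Finset.mem_filter, Finset.mem_univ, true_and] at hu ⊢
      exact ⟨hu.1.symm, hu.2.symm⟩
    · simp only [Finset.mem_filter, Finset.mem_univ, true_and] at hu hw
      have hwi : w.1 ≠ v.1 := fun h => hw ⟨h, fun h2 => hwv (Prod.ext h h2)⟩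
      exact (dist_le_of_same_gadget hcoord hu.1).trans (lt_dist_of_ne_gadget hcoord hwi).le
end
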